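/- Let a₀, a₁, a₂, a₃ and a₀′, a₁′, a₂′, a₃′ : ℕ → ℤ, all with the convention of value 0 at −1. Suppose that for all k ≥ 0 the two families produce the same values of the four expressions a₀(k) + a₀(k−1) − a₂(k−1), a₁(k) + a₁(k−1) − a₂(k−1), a₂(k) + a₂(k−1) − a₀(k) − a₁(k) − a₃(k−1), and a₃(k) + a₃(k−1) − 2·a₂(k) (i.e., each expression evaluated at the primed family equals its value at the unprimed family). Then aᵢ = aᵢ′ for i = 0, 1, 2, 3. -/

import Mathlib

/-- The value of a sequence at `k - 1`, with the convention that the value at `-1` is `0`. -/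
def prev (a : ℕ → ℤ) (k : ℕ) : ℤ := if k = 0 then 0 else a (k - 1)

theorem stmt_16 (a₀ a₁ a₂ a₃ a₀' a₁' a₂' a₃' : ℕ → ℤ)
    (h0 : ∀ k : ℕ, a₀' k + prev a₀' k - prev a₂' k = a₀ k + prev a₀ k - prev a₂ k)
    (h1 : ∀ k : ℕ, a₁' k + prev a₁' k - prev a₂' k = a₁ k + prev a₁ k - prev a₂ k)
    (h2 : ∀ k : ℕ, a₂' k + prev a₂' k - a₀' k - a₁' k - prev a₃' k =
                   a₂ k + prev a₂ k - a₀ k - a₁ k - prev a₃ k)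
    (h3 : ∀ k : ℕ, a₃' k + prev a₃' k - 2 * a₂' k = a₃ k + prev a₃ k - 2 * a₂ k) :
    a₀ = a₀' ∧ a₁ = a₁' ∧ a₂ = a₂' ∧ a₃ = a₃' := by
  have key : ∀ k, a₀ k = a₀' k ∧ a₁ k = a₁' k ∧ a₂ k = a₂' k ∧ a₃ k = a₃' k := by
    intro k
    have e0 := h0 k
    have e1 := h1 k
    have e2 := h2 k
    have e3 := h3 k
    induction k with
    | zero =>
      simp only [prev, if_true] at e0 e1 e2 e3
      omega
    | succ n ih =>
      have := ih (h0 n) (h1 n) (h2 n) (h3 n)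
      simp only [prev, Nat.add_eq_zero_iff, one_ne_zero, and_false, if_false,
        Nat.add_sub_cancel] at e0 e1 e2 e3
      omega
  exact ⟨funext fun k => (key k).1, funext fun k => (key k).2.1,
    funext fun k => (key k).2.2.1, funext fun k => (key k).2.2.2⟩
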